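/- arXiv:1505.07285 — 4 statements merged into one kernel-verified Lean document; each statement's English description precedes it below -/
import Mathlib

section
/- Let n ≥ 1. (a) For every g ∈ GL_n(ℝ) admitting a Cartan decomposition g = k₁ · diag(e^{X₁}, …, e^{Xₙ}) · k₂ with k₁, k₂ ∈ O(n) and X = (X₁,…,Xₙ) ∈ ℝⁿ satisfying X₁+⋯+Xₙ = 0, one has log(tr(g·gᵀ)/n) ≤ 2‖X‖. (b) For every R > 0 there exists a constant c > 0 (depending only on n and R) such that for every such g with ‖X‖ ≤ R one has c·‖X‖² ≤ log(tr(g·gᵀ)/n). -/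
open Matrix

/-- The squared Frobenius norm of `k₁ D k₂`, with `k₁, k₂` orthogonal, is that of `D`. -/
theorem trace_mul_transpose_of_cartan {n : ℕ} {g k₁ k₂ : Matrix (Fin n) (Fin n) ℝ}
    {X : Fin n → ℝ}
    (h₁ : k₁ ∈ Matrix.orthogonalGroup (Fin n) ℝ)
    (h₂ : k₂ ∈ Matrix.orthogonalGroup (Fin n) ℝ)
    (hg : g = k₁ * Matrix.diagonal (fun i => Real.exp (X i)) * k₂) :
    (g * gᵀ).trace = ∑ i, Real.exp (2 * X i) := by
  have e₁ : k₁ᵀ * k₁ = 1 := by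
    simpa [Matrix.star_eq_conjTranspose] using (Matrix.mem_orthogonalGroup_iff' (Fin n) ℝ).1 h₁
  have e₂ : k₂ * k₂ᵀ = 1 := by
    simpa [Matrix.star_eq_conjTranspose] using (Matrix.mem_orthogonalGroup_iff (Fin n) ℝ).1 h₂
  set D := Matrix.diagonal (fun i => Real.exp (X i)) with hD
  have h : g * gᵀ = k₁ * (D * D * k₁ᵀ) := by
    have hDt : Dᵀ = D := Matrix.diagonal_transpose _
    calc g * gᵀ = k₁ * D * (k₂ * k₂ᵀ) * D * k₁ᵀ := by
          rw [hg, Matrix.transpose_mul, Matrix.transpose_mul, hDt]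
          simp only [Matrix.mul_assoc]
      _ = k₁ * (D * D * k₁ᵀ) := by rw [e₂]; simp only [Matrix.mul_assoc, Matrix.one_mul]
  rw [h, Matrix.trace_mul_comm, Matrix.mul_assoc, e₁, Matrix.mul_one, hD,
    Matrix.diagonal_mul_diagonal, Matrix.trace_diagonal]
  refine Finset.sum_congr rfl fun i _ => ?_
  rw [← Real.exp_add, two_mul]

/-- A quadratic improvement of `1 + 2x ≤ exp (2x)` on bounded intervals. -/
theorem one_add_two_mul_add_sq_le_exp {R x : ℝ} (hx : |x| ≤ R) :
    1 + 2 * x + Real.exp (-R) ^ 2 * x ^ 2 ≤ Real.exp (2 * x) := by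
  have hu : x + 1 ≤ Real.exp x := Real.add_one_le_exp x
  have key : |Real.exp (-R) * x| ≤ |Real.exp x - 1| := by
    rw [abs_mul, abs_of_pos (Real.exp_pos _)]
    rcases le_total 0 x with h | h
    · have hR : Real.exp (-R) ≤ 1 := Real.exp_le_one_iff.2 (by linarith [abs_nonneg x])
      rw [abs_of_nonneg h, abs_of_nonneg (by linarith : 0 ≤ Real.exp x - 1)]
      nlinarith
    · have h1 : Real.exp x ≤ 1 := Real.exp_le_one_iff.2 h
      rw [abs_of_nonpos h] at hx ⊢
      rw [abs_of_nonpos (by linarith : Real.exp x - 1 ≤ 0)]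
      have hR : Real.exp (-R) ≤ Real.exp x := Real.exp_le_exp.2 (by linarith)
      have hm : Real.exp x * Real.exp (-x) = 1 := by rw [← Real.exp_add]; simp
      nlinarith [Real.add_one_le_exp (-x), Real.exp_pos x]
  have hsq := sq_le_sq.2 key
  rw [two_mul x, Real.exp_add]
  nlinarith

/-- Comparison between `ℒ(g) = log(tr(g·gᵀ)/n)` and the Cartan radial component `X(g)`:
(a) `ℒ(g) ≤ 2‖X‖` always; (b) for every `R > 0` there is `c > 0` (depending only on `n`
and `R`) with `c·‖X‖² ≤ ℒ(g)` whenever `‖X‖ ≤ R`. -/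
theorem statement1 (n : ℕ) (hn : 1 ≤ n) :
    (∀ (g k₁ k₂ : Matrix (Fin n) (Fin n) ℝ) (X : EuclideanSpace ℝ (Fin n)),
        k₁ ∈ Matrix.orthogonalGroup (Fin n) ℝ →
        k₂ ∈ Matrix.orthogonalGroup (Fin n) ℝ →
        (∑ i, X i) = 0 →
        g = k₁ * Matrix.diagonal (fun i => Real.exp (X i)) * k₂ →
        Real.log ((g * gᵀ).trace / n) ≤ 2 * ‖X‖) ∧
    (∀ R : ℝ, 0 < R → ∃ c : ℝ, 0 < c ∧
      ∀ (g k₁ k₂ : Matrix (Fin n) (Fin n) ℝ) (X : EuclideanSpace ℝ (Fin n)),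
        k₁ ∈ Matrix.orthogonalGroup (Fin n) ℝ →
        k₂ ∈ Matrix.orthogonalGroup (Fin n) ℝ →
        (∑ i, X i) = 0 →
        g = k₁ * Matrix.diagonal (fun i => Real.exp (X i)) * k₂ →
        ‖X‖ ≤ R →
        c * ‖X‖ ^ 2 ≤ Real.log ((g * gᵀ).trace / n)) := by
  have hn1 : (1 : ℝ) ≤ n := by exact_mod_cast hn
  have hn0 : (0 : ℝ) < n := by linarith
  have : Nonempty (Fin n) := ⟨⟨0, hn⟩⟩
  have hcoord (X : EuclideanSpace ℝ (Fin n)) (i : Fin n) : |X i| ≤ ‖X‖ := by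
    simpa using PiLp.norm_apply_le X i
  constructor
  · intro g k₁ k₂ X h₁ h₂ _ hg
    rw [trace_mul_transpose_of_cartan h₁ h₂ hg]
    have hpos : 0 < ∑ i, Real.exp (2 * X i) :=
      Finset.sum_pos (fun i _ => Real.exp_pos _) Finset.univ_nonempty
    rw [Real.log_le_iff_le_exp (by positivity), div_le_iff₀ hn0]
    calc ∑ i, Real.exp (2 * X i) ≤ ∑ _i : Fin n, Real.exp (2 * ‖X‖) :=
          Finset.sum_le_sum fun i _ =>
            Real.exp_le_exp.2 (by linarith [le_abs_self (X i), hcoord X i])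
      _ = Real.exp (2 * ‖X‖) * n := by simp [mul_comm]
  · intro R _
    refine ⟨Real.exp (-R) ^ 2 / n / (1 + R ^ 2), by positivity, ?_⟩
    intro g k₁ k₂ X h₁ h₂ hX hg hXR
    rw [trace_mul_transpose_of_cartan h₁ h₂ hg]
    have hsum : n + Real.exp (-R) ^ 2 * ‖X‖ ^ 2 ≤ ∑ i, Real.exp (2 * X i) := by
      calc n + Real.exp (-R) ^ 2 * ‖X‖ ^ 2
          = ∑ i, (1 + 2 * X i + Real.exp (-R) ^ 2 * X i ^ 2) := by
            simp [Finset.sum_add_distrib, ← Finset.mul_sum, hX, EuclideanSpace.real_norm_sq_eq]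
        _ ≤ _ := Finset.sum_le_sum fun i _ =>
            one_add_two_mul_add_sq_le_exp ((hcoord X i).trans hXR)
    set y := Real.exp (-R) ^ 2 / n * ‖X‖ ^ 2 with hy
    have hy0 : 0 ≤ y := by positivity
    have hyR : y ≤ R ^ 2 := by
      have ha : Real.exp (-R) ^ 2 ≤ 1 :=
        pow_le_one₀ (Real.exp_pos _).le (Real.exp_le_one_iff.2 (by linarith))
      have hb : Real.exp (-R) ^ 2 / n ≤ 1 := (div_le_one hn0).2 (ha.trans hn1)
      have hc : ‖X‖ ^ 2 ≤ R ^ 2 := pow_le_pow_left₀ (norm_nonneg _) hXR 2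
      exact (mul_le_of_le_one_left (by positivity) hb).trans hc
    have havg : 1 + y ≤ (∑ i, Real.exp (2 * X i)) / n := by
      rw [le_div_iff₀ hn0]
      refine le_of_eq_of_le ?_ hsum
      rw [hy]
      field_simp
    calc Real.exp (-R) ^ 2 / n / (1 + R ^ 2) * ‖X‖ ^ 2 = y / (1 + R ^ 2) := by rw [hy]; ring
      _ ≤ y / (1 + y) := by gcongr
      _ = 1 - (1 + y)⁻¹ := by field_simp; ring
      _ ≤ Real.log (1 + y) := Real.one_sub_inv_le_log_of_pos (by positivity)
      _ ≤ _ := Real.log_le_log (by positivity) havg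
end

section
/- Let n ≥ 1, and let b : {1,…,n} → ℕ be a weakly increasing function (the block map of a standard parabolic subgroup of GL_n). Let m ∈ GL_n(ℝ) be block diagonal, i.e. m_{ij} = 0 whenever b(i) ≠ b(j), and let u be block upper-triangular unipotent, i.e. u_{ii} = 1 for all i and u_{ij} = 0 unless i = j or b(i) < b(j). Then tr((mu)ᵀ·(mu)) = tr(mᵀ·m) + tr((mu − m)ᵀ·(mu − m)). -/
open Matrix

/-- If `m` is block diagonal and `v` vanishes within each block, then `mᵀ * (m * v)` is
traceless. -/
theorem trace_transpose_mul_mul_eq_zero_of_blocks {ι β R : Type*} [Fintype ι] [CommRing R]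
    (b : ι → β) {m v : Matrix ι ι R} (hm : ∀ i j, b i ≠ b j → m i j = 0)
    (hv : ∀ i j, b i = b j → v i j = 0) : (mᵀ * (m * v)).trace = 0 := by
  simp only [trace, diag_apply, mul_apply, transpose_apply]
  refine Finset.sum_eq_zero fun i _ => Finset.sum_eq_zero fun k _ => ?_
  by_cases hki : b k = b i
  · rw [Finset.sum_eq_zero, mul_zero]
    intro j _
    by_cases hkj : b k = b j
    · rw [hv j i (hkj.symm.trans hki), mul_zero]
    · rw [hm k j hkj, zero_mul]
  · rw [hm k i hki, zero_mul]

/-- The Pythagorean identity for the trace form `(x, y) ↦ tr (xᵀ * y)`. -/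
theorem trace_transpose_mul_self_add {m n R : Type*} [Fintype m] [Fintype n] [CommRing R]
    {x y : Matrix m n R} (h : (xᵀ * y).trace = 0) :
    ((x + y)ᵀ * (x + y)).trace = (xᵀ * x).trace + (yᵀ * y).trace := by
  have h' : (yᵀ * x).trace = 0 := by
    rw [← trace_transpose, transpose_mul, transpose_transpose, h]
  simp only [transpose_add, trace_add, h, h', Matrix.add_mul, Matrix.mul_add]
  ring

/-- For `m` block diagonal and `u` block upper-triangular unipotent (with respect to a
weakly increasing block map `b`), one has
`tr((mu)ᵀ(mu)) = tr(mᵀm) + tr((mu − m)ᵀ(mu − m))`. -/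
theorem statement2 (n : ℕ) (hn : 1 ≤ n) (b : Fin n → ℕ) (hb : Monotone b)
    (m u : Matrix (Fin n) (Fin n) ℝ)
    (hm : IsUnit m.det)
    (hmblock : ∀ i j, b i ≠ b j → m i j = 0)
    (hudiag : ∀ i, u i i = 1)
    (hu : ∀ i j, i ≠ j → ¬ b i < b j → u i j = 0) :
    ((m * u)ᵀ * (m * u)).trace =
      (mᵀ * m).trace + ((m * u - m)ᵀ * (m * u - m)).trace := by
  have hv : ∀ i j, b i = b j → (u - 1) i j = 0 := by
    intro i j hij
    obtain rfl | hne := eq_or_ne i j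
    · simp [hudiag]
    · simp [hu i j hne hij.not_lt, hne]
  have hcross : (mᵀ * (m * u - m)).trace = 0 := by
    simpa [Matrix.mul_sub] using trace_transpose_mul_mul_eq_zero_of_blocks b hmblock hv
  simpa using trace_transpose_mul_self_add hcross
end

section
/- Let n ≥ 1, and let b : {1,…,n} → ℕ be a weakly increasing function (the block map of a standard parabolic subgroup of GL_n). Let m ∈ GL_n(ℝ) be block diagonal (m_{ij} = 0 whenever b(i) ≠ b(j)) with |det m| = 1, let u be block upper-triangular unipotent (u_{ii} = 1 and u_{ij} = 0 unless i = j or b(i) < b(j)), let k ∈ O(n), and set g = m·u·k. Then ℒ(g) ≥ ℒ(m) and ℒ(g) ≥ ℒ(1 + m·(u − 1)), where ℒ(h) := log(tr(h·hᵀ)/n); equivalently tr(g·gᵀ) ≥ tr(m·mᵀ) and tr(g·gᵀ) ≥ tr((1 + m(u−1))·(1 + m(u−1))ᵀ). -/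
open Matrix

namespace Matrix

variable {ι : Type*} [Fintype ι]

theorem trace_mul_transpose_self_nonneg (A : Matrix ι ι ℝ) : 0 ≤ (A * Aᵀ).trace := by
  simp only [trace, diag_apply, mul_apply, transpose_apply]
  exact Finset.sum_nonneg fun i _ => Finset.sum_nonneg fun j _ => mul_self_nonneg _

/-- Pythagoras for the Frobenius norm of matrices with disjoint supports. -/
theorem trace_add_mul_transpose_add (A B : Matrix ι ι ℝ) (h : ∀ i j, A i j * B i j = 0) :
    ((A + B) * (A + B)ᵀ).trace = (A * Aᵀ).trace + (B * Bᵀ).trace := by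
  simp only [trace, diag_apply, mul_apply, transpose_apply, add_apply]
  rw [← Finset.sum_add_distrib]
  refine Finset.sum_congr rfl fun i _ => ?_
  rw [← Finset.sum_add_distrib]
  refine Finset.sum_congr rfl fun j _ => ?_
  linear_combination 2 * h i j

theorem card_le_trace_mul_transpose_self [DecidableEq ι] (A : Matrix ι ι ℝ)
    (hA : |A.det| = 1) : (Fintype.card ι : ℝ) ≤ (A * Aᵀ).trace := by
  have hP : (A * Aᵀ).PosSemidef := by
    simpa only [conjTranspose_eq_transpose_of_trivial] using posSemidef_self_mul_conjTranspose A
  have hdet : ∏ i, hP.1.eigenvalues i = 1 := by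
    have h := hP.1.det_eq_prod_eigenvalues
    rw [det_mul, det_transpose, ← abs_mul_abs_self, hA, one_mul] at h
    simpa using h.symm
  have hne (i : ι) : hP.1.eigenvalues i ≠ 0 := fun h0 => by
    rw [Finset.prod_eq_zero (Finset.mem_univ i) h0] at hdet
    exact zero_ne_one hdet
  have hlog : ∑ i, Real.log (hP.1.eigenvalues i) = 0 := by
    rw [← Real.log_prod fun i _ => hne i, hdet, Real.log_one]
  have hsum : ∑ i, Real.log (hP.1.eigenvalues i) ≤ ∑ i, (hP.1.eigenvalues i - 1) :=
    Finset.sum_le_sum fun i _ =>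
      Real.log_le_sub_one_of_pos ((hP.eigenvalues_nonneg i).lt_of_ne (hne i).symm)
  have htr : (A * Aᵀ).trace = ∑ i, hP.1.eigenvalues i := by
    simpa using hP.1.trace_eq_sum_eigenvalues
  rw [hlog, Finset.sum_sub_distrib, ← htr] at hsum
  simpa using hsum

end Matrix

/-- Iwasawa inequality for `ℒ(h) = log(tr(h·hᵀ)/n)`: if `g = m·u·k` with `m` block
diagonal satisfying `|det m| = 1`, `u` block upper-triangular unipotent and `k ∈ O(n)`,
then `ℒ(g) ≥ ℒ(m)` and `ℒ(g) ≥ ℒ(1 + m(u−1))`; equivalently `tr(g·gᵀ) ≥ tr(m·mᵀ)` and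
`tr(g·gᵀ) ≥ tr((1 + m(u−1))·(1 + m(u−1))ᵀ)`. -/
theorem statement3 (n : ℕ) (hn : 1 ≤ n) (b : Fin n → ℕ) (hb : Monotone b)
    (m u k g : Matrix (Fin n) (Fin n) ℝ)
    (hmblock : ∀ i j, b i ≠ b j → m i j = 0)
    (hmdet : |m.det| = 1)
    (hudiag : ∀ i, u i i = 1)
    (hu : ∀ i j, i ≠ j → ¬ b i < b j → u i j = 0)
    (hk : k ∈ Matrix.orthogonalGroup (Fin n) ℝ)
    (hg : g = m * u * k) :
    (Real.log ((m * mᵀ).trace / n) ≤ Real.log ((g * gᵀ).trace / n) ∧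
      Real.log (((1 + m * (u - 1)) * (1 + m * (u - 1))ᵀ).trace / n) ≤
        Real.log ((g * gᵀ).trace / n)) ∧
    ((m * mᵀ).trace ≤ (g * gᵀ).trace ∧
      ((1 + m * (u - 1)) * (1 + m * (u - 1))ᵀ).trace ≤ (g * gᵀ).trace) := by
  have hN : ∀ i j, b i = b j → (m * (u - 1)) i j = 0 := by
    intro i j hij
    rw [mul_apply]
    refine Finset.sum_eq_zero fun l _ => ?_
    by_cases hil : b i = b l
    · have hlj : (u - 1) l j = 0 := by
        by_cases h : l = j
        · subst h
          simp [hudiag]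
        · simp [h, hu l j h (by omega)]
      rw [hlj, mul_zero]
    · rw [hmblock i l hil, zero_mul]
  have hgg : (g * gᵀ).trace = (m * mᵀ).trace + ((m * (u - 1)) * (m * (u - 1))ᵀ).trace := by
    have hkk : k * kᵀ = 1 := by
      simpa [star_eq_conjTranspose] using (mem_orthogonalGroup_iff (Fin n) ℝ).1 hk
    have hmu : g * gᵀ = (m + m * (u - 1)) * (m + m * (u - 1))ᵀ := by
      have : m + m * (u - 1) = m * u := by noncomm_ring
      rw [this, hg, transpose_mul (m * u) k, Matrix.mul_assoc, ← Matrix.mul_assoc k, hkk,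
        Matrix.one_mul]
    rw [hmu, trace_add_mul_transpose_add]
    intro i j
    by_cases h : b i = b j
    · rw [hN i j h, mul_zero]
    · rw [hmblock i j h, zero_mul]
  have h1 : ((1 + m * (u - 1)) * (1 + m * (u - 1))ᵀ).trace =
      (n : ℝ) + ((m * (u - 1)) * (m * (u - 1))ᵀ).trace := by
    rw [trace_add_mul_transpose_add]
    · simp
    · intro i j
      by_cases h : i = j
      · rw [hN i j (congrArg b h), mul_zero]
      · rw [one_apply_ne h, zero_mul]
  have hm : (n : ℝ) ≤ (m * mᵀ).trace := by
    simpa using card_le_trace_mul_transpose_self m hmdet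
  have hNN := trace_mul_transpose_self_nonneg (m * (u - 1))
  have hn0 : (0 : ℝ) < n := by exact_mod_cast hn
  have le1 : (m * mᵀ).trace ≤ (g * gᵀ).trace := by linarith
  have le2 : ((1 + m * (u - 1)) * (1 + m * (u - 1))ᵀ).trace ≤ (g * gᵀ).trace := by linarith
  refine ⟨⟨Real.log_le_log (div_pos (by linarith) hn0) ?_,
    Real.log_le_log (div_pos (by linarith) hn0) ?_⟩, le1, le2⟩
  · gcongr
  · gcongr
end

section
/- Let n ≥ 1, let b : {1,…,n} → ℕ be weakly increasing, let N = #{(i,j) : 1 ≤ i < j ≤ n, b(i) < b(j)}, and let p : ℝᴺ → ℝᵐ be a polynomial map with p(0) = 0 (no constant term). Then there exists a constant a > 0, depending only on n and p, such that for every ε ∈ (0,1) and every block upper-triangular unipotent matrix v ∈ GL_n(ℝ) (v_{ii} = 1 and v_{ij} = 0 unless i = j or b(i) < b(j)) admitting a Cartan decomposition v = k₁·diag(e^{X₁},…,e^{Xₙ})·k₂ with k₁, k₂ ∈ O(n), X₁+⋯+Xₙ = 0, and ‖X‖ < ε, one has ‖p(v)‖ < a·ε^{1/2}, where p(v) means p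 evaluated at the vector of strictly-upper entries (v_{ij})_{i<j, b(i)<b(j)} of v. -/
open Matrix

/-- On the box of radius `R * t` with `0 ≤ t ≤ 1`, a polynomial stays within `O(t)` of its
constant term. -/
theorem MvPolynomial.exists_abs_eval_sub_le {σ : Type*} (P : MvPolynomial σ ℝ) (R : ℝ) :
    ∃ C : ℝ, 0 ≤ C ∧ ∀ t : ℝ, 0 ≤ t → t ≤ 1 → ∀ x : σ → ℝ, (∀ i, |x i| ≤ R * t) →
      |MvPolynomial.eval x P - MvPolynomial.eval (fun _ => (0 : ℝ)) P| ≤ C * t := by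
  induction P using MvPolynomial.induction_on with
  | C r => exact ⟨0, le_rfl, fun t _ _ x _ => by simp⟩
  | add P Q hP hQ =>
    obtain ⟨A, hA, hP⟩ := hP
    obtain ⟨B, hB, hQ⟩ := hQ
    refine ⟨A + B, add_nonneg hA hB, fun t h0 h1 x hx => ?_⟩
    rw [map_add, map_add, add_sub_add_comm, add_mul]
    exact (abs_add_le _ _).trans (add_le_add (hP t h0 h1 x hx) (hQ t h0 h1 x hx))
  | mul_X P i hP =>
    obtain ⟨A, hA, hP⟩ := hP
    set c := MvPolynomial.eval (fun _ => (0 : ℝ)) P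
    refine ⟨(A + |c|) * |R|, by positivity, fun t h0 h1 x hx => ?_⟩
    have hbound : |MvPolynomial.eval x P| ≤ A + |c| := by
      have h := hP t h0 h1 x hx
      have h' := abs_sub_abs_le_abs_sub (MvPolynomial.eval x P) c
      have hAt : A * t ≤ A := mul_le_of_le_one_right hA h1
      linarith
    have hxi : |x i| ≤ |R| * t :=
      (hx i).trans (mul_le_mul_of_nonneg_right (le_abs_self R) h0)
    simp only [map_mul, MvPolynomial.eval_X, mul_zero, sub_zero, abs_mul]
    rw [mul_assoc]
    exact mul_le_mul hbound hxi (abs_nonneg _) (by positivity)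

/-- The squared Frobenius norm of `k₁ * diagonal d * k₂` with `k₁`, `k₂` orthogonal is the sum
of the `d i ^ 2`. -/
theorem Matrix.sum_sq_orthogonal_mul_diagonal_mul {ι : Type*} [Fintype ι] [DecidableEq ι]
    {k₁ k₂ : Matrix ι ι ℝ} (h₁ : k₁ ∈ Matrix.orthogonalGroup ι ℝ)
    (h₂ : k₂ ∈ Matrix.orthogonalGroup ι ℝ) (d : ι → ℝ) :
    ∑ i, ∑ j, (k₁ * Matrix.diagonal d * k₂) i j ^ 2 = ∑ i, d i ^ 2 := by
  have hk₁ : k₁ᵀ * k₁ = 1 := (Matrix.mem_orthogonalGroup_iff' _ _).mp h₁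
  have hk₂ : k₂ * k₂ᵀ = 1 := (Matrix.mem_orthogonalGroup_iff _ _).mp h₂
  set v := k₁ * Matrix.diagonal d * k₂ with hv
  have hmul : v * vᵀ = k₁ * (Matrix.diagonal d * Matrix.diagonal d * k₁ᵀ) := by
    calc v * vᵀ = k₁ * Matrix.diagonal d * (k₂ * k₂ᵀ) * (Matrix.diagonal d * k₁ᵀ) := by
          simp only [hv, Matrix.transpose_mul, Matrix.diagonal_transpose, Matrix.mul_assoc]
      _ = _ := by rw [hk₂, Matrix.mul_one]; simp only [Matrix.mul_assoc]
  have htrace : (v * vᵀ).trace = ∑ i, d i ^ 2 := by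
    rw [hmul, Matrix.trace_mul_comm, Matrix.mul_assoc, hk₁, Matrix.mul_one,
      Matrix.diagonal_mul_diagonal, Matrix.trace_diagonal]
    simp only [sq]
  rw [← htrace]
  simp only [Matrix.trace, Matrix.diag_apply, Matrix.mul_apply, Matrix.transpose_apply, sq]

/-- In a matrix with unit diagonal, an off-diagonal entry is controlled by the excess of the
squared Frobenius norm over that of the identity. -/
theorem Matrix.sq_apply_le_of_diag_eq_one {ι : Type*} [Fintype ι] [DecidableEq ι]
    {v : Matrix ι ι ℝ} (hv : ∀ i, v i i = 1) {i j : ι} (hij : i ≠ j) :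
    v i j ^ 2 ≤ ∑ k, ∑ l, v k l ^ 2 - Fintype.card ι := by
  have hrow : ∀ k, 1 ≤ ∑ l, v k l ^ 2 := fun k => by
    simpa [hv k] using
      Finset.single_le_sum (f := fun l => v k l ^ 2) (fun l _ => sq_nonneg _) (Finset.mem_univ k)
  have hpair : 1 + v i j ^ 2 ≤ ∑ l, v i l ^ 2 := by
    have h := Finset.sum_le_sum_of_subset_of_nonneg (f := fun l => v i l ^ 2)
      (Finset.subset_univ {i, j}) (fun l _ _ => sq_nonneg _)
    simpa [Finset.sum_pair hij, hv i] using h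
  have hsum : ∑ k, ((∑ l, v k l ^ 2) - 1) = ∑ k, ∑ l, v k l ^ 2 - Fintype.card ι := by
    simp [Finset.sum_sub_distrib]
  rw [← hsum]
  refine le_trans ?_ (Finset.single_le_sum (f := fun k => (∑ l, v k l ^ 2) - 1)
    (fun k _ => sub_nonneg.mpr (hrow k)) (Finset.mem_univ i))
  linarith

theorem Real.exp_sq_le_one_add_mul {x ε : ℝ} (hx : x ≤ ε) (h0 : 0 ≤ ε) (h1 : ε ≤ 1) :
    Real.exp x ^ 2 ≤ 1 + 8 * ε := by
  have hconv := convexOn_exp.2 (Set.mem_univ 0) (Set.mem_univ 1) (sub_nonneg.mpr h1) h0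
    (sub_add_cancel 1 ε)
  simp only [smul_eq_mul, mul_zero, mul_one, zero_add, Real.exp_zero] at hconv
  have he : Real.exp 1 < 3 := Real.exp_one_lt_three
  have hxε : Real.exp x ≤ 1 + 2 * ε := by
    have := Real.exp_le_exp.mpr hx
    nlinarith
  have hpos := Real.exp_pos x
  nlinarith

/-- For a polynomial map `p` without constant term on the unipotent radical `V` of a
standard parabolic subgroup of `GL_n(ℝ)` (coordinatized by its strictly-upper block
entries), there is `a > 0` depending only on `n`, `b` and `p` such that for every
`ε ∈ (0,1)` and every `v ∈ V` whose Cartan radial component satisfies `‖X(v)‖ < ε`,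
one has `‖p(v)‖ < a·ε^{1/2}`. -/
theorem statement9 (n : ℕ) (hn : 1 ≤ n) (b : Fin n → ℕ) (hb : Monotone b)
    (m : ℕ)
    (p : Fin m → MvPolynomial {q : Fin n × Fin n // q.1 < q.2 ∧ b q.1 < b q.2} ℝ)
    (hp : ∀ j, MvPolynomial.eval (fun _ => (0 : ℝ)) (p j) = 0) :
    ∃ a : ℝ, 0 < a ∧
      ∀ (ε : ℝ), 0 < ε → ε < 1 →
      ∀ (v k₁ k₂ : Matrix (Fin n) (Fin n) ℝ) (X : EuclideanSpace ℝ (Fin n)),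
        (∀ i, v i i = 1) →
        (∀ i j, i ≠ j → ¬ b i < b j → v i j = 0) →
        k₁ ∈ Matrix.orthogonalGroup (Fin n) ℝ →
        k₂ ∈ Matrix.orthogonalGroup (Fin n) ℝ →
        (∑ i, X i = 0) →
        v = k₁ * Matrix.diagonal (fun i => Real.exp (X i)) * k₂ →
        ‖X‖ < ε →
        Real.sqrt (∑ j, (MvPolynomial.eval (fun q => v q.1.1 q.1.2) (p j)) ^ 2) <
          a * Real.sqrt ε := by
  choose C _ hC using fun j => (p j).exists_abs_eval_sub_le √(8 * n)
  refine ⟨√(∑ j, C j ^ 2) + 1, by positivity, ?_⟩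
  intro ε hε hε1 v k₁ k₂ X hdiag _ hk₁ hk₂ _ hv hX
  have hexp : ∀ i, Real.exp (X i) ^ 2 ≤ 1 + 8 * ε := fun i =>
    Real.exp_sq_le_one_add_mul
      (((le_abs_self _).trans (PiLp.norm_apply_le X i)).trans hX.le) hε.le hε1.le
  have hfrob : ∑ i, ∑ j, v i j ^ 2 ≤ n * (1 + 8 * ε) := by
    rw [hv, Matrix.sum_sq_orthogonal_mul_diagonal_mul hk₁ hk₂]
    simpa only [Finset.card_univ, Fintype.card_fin, nsmul_eq_mul] using
      Finset.sum_le_card_nsmul Finset.univ _ _ fun i _ => hexp i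
  have hentry : ∀ q : {q : Fin n × Fin n // q.1 < q.2 ∧ b q.1 < b q.2},
      |v q.1.1 q.1.2| ≤ √(8 * n) * √ε := fun q => by
    rw [← Real.sqrt_mul (by positivity)]
    apply Real.abs_le_sqrt
    have h := Matrix.sq_apply_le_of_diag_eq_one hdiag q.2.1.ne
    rw [Fintype.card_fin] at h
    linarith
  have hpoly : ∀ j, |MvPolynomial.eval (fun q => v q.1.1 q.1.2) (p j)| ≤ C j * √ε := fun j => by
    simpa only [hp j, sub_zero] using hC j √ε (Real.sqrt_nonneg _) (Real.sqrt_le_one.mpr hε1.le) _ hentry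
  calc _ ≤ √((∑ j, C j ^ 2) * ε) := by
        refine Real.sqrt_le_sqrt ?_
        rw [Finset.sum_mul]
        refine Finset.sum_le_sum fun j _ => ?_
        have h := pow_le_pow_left₀ (abs_nonneg _) (hpoly j) 2
        rwa [sq_abs, mul_pow, Real.sq_sqrt hε.le] at h
    _ = √(∑ j, C j ^ 2) * √ε := Real.sqrt_mul (by positivity) _
    _ < _ := by
        have := Real.sqrt_pos.mpr hε
        linarith
end
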